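/- Let n ≥ 3 be an integer. There exists a constant C > 0, depending only on n, such that for all a, b ∈ ℝ^n and all λ, μ > 0: ∫_{ℝ^n} U_{a,λ}(x)^{n/(n−2)} U_{b,μ}(x)^{n/(n−2)} dx ≤ C · ε(a, b, λ, μ)^{n/(n−2)} · (1 + |log ε(a, b, λ, μ)|), where ε(a, b, λ, μ) = (μ/λ + λ/μ + λμ |a−b|²)^{−(n−2)/2}. -/

import Mathlib

open MeasureTheory

/-- The standard bubble `U_{a,λ}(x) = (λ/(1+λ²|x−a|²))^{(n-2)/2}` on `ℝⁿ`. -/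
noncomputable def bubble (n : ℕ) (a : EuclideanSpace ℝ (Fin n)) (lam : ℝ)
    (x : EuclideanSpace ℝ (Fin n)) : ℝ :=
  (lam / (1 + lam ^ 2 * ‖x - a‖ ^ 2)) ^ (((n : ℝ) - 2) / 2)

open Set Filter Topology

/-- Up to a constant, Feynman's parametrization bounds a product of negative powers from above. -/
lemma ofReal_rpow_neg_mul_rpow_neg_le {p q s : ℝ} (hp : 0 < p) (hq : 0 < q) (hs : 1 ≤ s) :
    ENNReal.ofReal (p ^ (-s) * q ^ (-s)) ≤ ENNReal.ofReal (3 ^ (2 * s)) *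
      ∫⁻ t in Ioi (0 : ℝ), ENNReal.ofReal (t ^ (s - 1) * (p + t * q) ^ (-(2 * s))) := by
  set r := p / q with hr
  have hr0 : 0 < r := by positivity
  have hrq : r * q = p := by rw [hr]; field_simp
  have key : ENNReal.ofReal (r ^ (s - 1) * (3 * p) ^ (-(2 * s))) * ENNReal.ofReal r ≤
      ∫⁻ t in Ioi (0 : ℝ), ENNReal.ofReal (t ^ (s - 1) * (p + t * q) ^ (-(2 * s))) := by
    calc ENNReal.ofReal (r ^ (s - 1) * (3 * p) ^ (-(2 * s))) * ENNReal.ofReal r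
        = ∫⁻ _ in Icc r (2 * r), ENNReal.ofReal (r ^ (s - 1) * (3 * p) ^ (-(2 * s))) := by
          rw [setLIntegral_const, Real.volume_Icc]
          congr 2
          ring
      _ ≤ ∫⁻ t in Icc r (2 * r), ENNReal.ofReal (t ^ (s - 1) * (p + t * q) ^ (-(2 * s))) := by
          refine setLIntegral_mono' measurableSet_Icc fun t ht => ENNReal.ofReal_le_ofReal ?_
          have ht0 : 0 < t := hr0.trans_le ht.1
          refine mul_le_mul (Real.rpow_le_rpow hr0.le ht.1 (by linarith)) ?_
            (by positivity) (by positivity)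
          refine Real.rpow_le_rpow_of_nonpos (by positivity) ?_ (by linarith)
          nlinarith [ht.2, mul_le_mul_of_nonneg_right ht.2 hq.le]
      _ ≤ _ := lintegral_mono_set fun t ht => hr0.trans_le ht.1
  refine le_trans (le_of_eq ?_) (mul_le_mul_right key _)
  rw [← ENNReal.ofReal_mul (by positivity), ← ENNReal.ofReal_mul (by positivity)]
  congr 1
  have h1 : r ^ (s - 1) * r = r ^ s := by
    rw [← Real.rpow_add_one hr0.ne']; congr 1; ring
  have h2 : (3 : ℝ) ^ (2 * s) * (3 * p) ^ (-(2 * s)) = p ^ (-(2 * s)) := by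
    rw [Real.mul_rpow (by norm_num) hp.le, ← mul_assoc, ← Real.rpow_add (by norm_num)]
    simp
  calc p ^ (-s) * q ^ (-s) = p ^ s * q ^ (-s) * p ^ (-(2 * s)) := by
        rw [mul_right_comm, ← Real.rpow_add hp]; congr 2; ring
    _ = r ^ s * p ^ (-(2 * s)) := by
        rw [hr, Real.div_rpow hp.le hq.le, Real.rpow_neg hq.le, div_eq_mul_inv]
    _ = _ := by rw [← h1, ← h2]; ring

lemma lintegral_rpow_neg_add_mul_norm_sub_sq {n : ℕ} (hn : 0 < n) {α β : ℝ} (hα : 0 < α)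
    (hβ : 0 < β) (c : EuclideanSpace ℝ (Fin n)) :
    ∫⁻ x, ENNReal.ofReal ((β + α * ‖x - c‖ ^ 2) ^ (-(n : ℝ))) =
      ENNReal.ofReal ((α * β) ^ (-((n : ℝ) / 2)) *
        ∫ x : EuclideanSpace ℝ (Fin n), (1 + ‖x‖ ^ 2) ^ (-(n : ℝ))) := by
  have hint : Integrable fun x : EuclideanSpace ℝ (Fin n) => (1 + ‖x‖ ^ 2) ^ (-(n : ℝ)) := by
    have := integrable_rpow_neg_one_add_norm_sq (E := EuclideanSpace ℝ (Fin n)) (μ := volume)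
      (r := 2 * n) (by
        have : (0 : ℝ) < n := by exact_mod_cast hn
        simp; linarith)
    convert this using 3
    ring
  set R := √(α / β) with hR
  have hR0 : 0 < R := Real.sqrt_pos.2 (by positivity)
  have hR2 : R ^ 2 = α / β := Real.sq_sqrt (by positivity)
  have hpt : ∀ x : EuclideanSpace ℝ (Fin n), (β + α * ‖x‖ ^ 2) ^ (-(n : ℝ)) =
      β ^ (-(n : ℝ)) * (1 + ‖R • x‖ ^ 2) ^ (-(n : ℝ)) := by
    intro x
    rw [← Real.mul_rpow hβ.le (by positivity), norm_smul, mul_pow, Real.norm_eq_abs, sq_abs, hR2]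
    congr 1
    field_simp
  rw [lintegral_sub_right_eq_self
    (fun x : EuclideanSpace ℝ (Fin n) => ENNReal.ofReal ((β + α * ‖x‖ ^ 2) ^ (-(n : ℝ)))) c]
  simp_rw [hpt]
  rw [← ofReal_integral_eq_lintegral_ofReal
    (((integrable_comp_smul_iff volume _ hR0.ne').2 hint).const_mul _)
    (Eventually.of_forall fun x => by simp only [Pi.zero_apply]; positivity)]
  congr 1
  rw [integral_const_mul, Measure.integral_comp_smul_of_nonneg volume
    (fun x : EuclideanSpace ℝ (Fin n) => (1 + ‖x‖ ^ 2) ^ (-(n : ℝ))) R (hR := hR0.le),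
    smul_eq_mul, ← mul_assoc]
  congr 1
  have h1 : (R ^ Module.finrank ℝ (EuclideanSpace ℝ (Fin n)))⁻¹ = (α / β) ^ (-((n : ℝ) / 2)) := by
    rw [finrank_euclideanSpace_fin, ← Real.rpow_natCast, ← Real.rpow_neg hR0.le, hR,
      Real.sqrt_eq_rpow, ← Real.rpow_mul (by positivity)]
    congr 1
    ring
  rw [h1, Real.div_rpow hα.le hβ.le, Real.mul_rpow hα.le hβ.le, div_eq_mul_inv,
    ← Real.rpow_neg hβ.le, mul_left_comm, ← Real.rpow_add hβ]
  congr 2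
  ring

lemma add_mul_add_eq_norm_sq {V : Type*} [NormedAddCommGroup V] [InnerProductSpace ℝ V]
    (a b x : V) {l m : ℝ} (hlm : l + m ≠ 0) :
    l * ‖x - a‖ ^ 2 + m * ‖x - b‖ ^ 2 =
      l * m / (l + m) * ‖a - b‖ ^ 2 + (l + m) * ‖x - (l + m)⁻¹ • (l • a + m • b)‖ ^ 2 := by
  have h1 : x - (l + m)⁻¹ • (l • a + m • b) = (l + m)⁻¹ • (l • (x - a) + m • (x - b)) := by
    have : x = (l + m)⁻¹ • ((l + m) • x) := by rw [smul_smul, inv_mul_cancel₀ hlm, one_smul]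
    nth_rewrite 1 [this]
    module
  have h2 : a - b = (x - b) - (x - a) := by abel
  rw [h1, h2, norm_smul, mul_pow, Real.norm_eq_abs, sq_abs, norm_sub_sq_real (x - b), norm_add_sq_real,
    norm_smul, norm_smul, mul_pow, mul_pow, Real.norm_eq_abs, Real.norm_eq_abs, sq_abs, sq_abs,
    inner_smul_left, inner_smul_right, real_inner_comm (x - a) (x - b)]
  simp only [conj_trivial]
  field_simp
  ring

lemma lintegral_inv_add_mul_add_Ioi {E : ℝ} (hE : 2 ≤ E) :
    ∫⁻ t in Ioi (0 : ℝ), ENNReal.ofReal (((t + E⁻¹) * (t + E))⁻¹) =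
      ENNReal.ofReal (2 * Real.log E / (E - E⁻¹)) := by
  have hE0 : 0 < E := by linarith
  have hi : E⁻¹ ≤ 2⁻¹ := inv_anti₀ (by norm_num) hE
  have hi0 : 0 < E⁻¹ := by positivity
  have hd : 0 < E - E⁻¹ := by linarith
  have hderiv : ∀ t ∈ Ici (0 : ℝ), HasDerivAt
      (fun t => (Real.log (t + E⁻¹) - Real.log (t + E)) / (E - E⁻¹))
      (((t + E⁻¹) * (t + E))⁻¹) t := by
    intro t ht
    have ht : 0 ≤ t := ht
    have h1 : t + E⁻¹ ≠ 0 := by positivity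
    have h2 : t + E ≠ 0 := by positivity
    have := ((((hasDerivAt_id t).add_const E⁻¹).log h1).sub
      (((hasDerivAt_id t).add_const E).log h2)).div_const (E - E⁻¹)
    refine this.congr_deriv ?_
    simp only [id]
    rw [div_sub_div _ _ h1 h2, div_div, div_eq_iff (by positivity),
      inv_mul_cancel_left₀ (mul_ne_zero h1 h2)]
    ring
  have hpos : ∀ t ∈ Ioi (0 : ℝ), 0 ≤ ((t + E⁻¹) * (t + E))⁻¹ := by
    intro t ht
    have ht : 0 < t := ht
    positivity
  have hlim : Tendsto (fun t => (Real.log (t + E⁻¹) - Real.log (t + E)) / (E - E⁻¹))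
      atTop (𝓝 0) := by
    have h := (Real.tendsto_log_comp_add_sub_log E⁻¹).sub (Real.tendsto_log_comp_add_sub_log E)
    have h' := h.div_const (E - E⁻¹)
    simpa using h'
  have hint := integrableOn_Ioi_deriv_of_nonneg' hderiv hpos hlim
  rw [← ofReal_integral_eq_lintegral_ofReal hint
    ((ae_restrict_iff' measurableSet_Ioi).2 (Eventually.of_forall hpos)),
    integral_Ioi_of_hasDerivAt_of_nonneg' hderiv hpos hlim]
  congr 1
  simp only [zero_add, Real.log_inv]
  ring

lemma lintegral_rpow_mul_rpow_neg_le {s E : ℝ} (hs : 1 ≤ s) (hE : 2 ≤ E) :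
    ∫⁻ t in Ioi (0 : ℝ), ENNReal.ofReal (t ^ (s - 1) * (1 + t * E + t ^ 2) ^ (-s)) ≤
      ENNReal.ofReal (10 / 3 * (E ^ (-s) * Real.log E)) := by
  have hE0 : 0 < E := by linarith
  have hi : E⁻¹ ≤ 2⁻¹ := inv_anti₀ (by norm_num) hE
  have hlog : 0 ≤ Real.log E := Real.log_nonneg (by linarith)
  calc _ ≤ ∫⁻ t in Ioi (0 : ℝ), ENNReal.ofReal (5 / 4 * E ^ (1 - s)) *
        ENNReal.ofReal (((t + E⁻¹) * (t + E))⁻¹) := by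
        refine setLIntegral_mono' measurableSet_Ioi fun t ht => ?_
        have ht : 0 < t := ht
        rw [← ENNReal.ofReal_mul (by positivity)]
        refine ENNReal.ofReal_le_ofReal ?_
        set D := 1 + t * E + t ^ 2 with hD
        have hD0 : 0 < D := by positivity
        have h1 : t ^ (s - 1) * D ^ (-s) = (t / D) ^ (s - 1) * D⁻¹ := by
          rw [Real.div_rpow ht.le hD0.le, div_eq_mul_inv, ← Real.rpow_neg hD0.le, mul_assoc,
            ← Real.rpow_neg_one D, ← Real.rpow_add hD0]
          congr 2
          ring
        have h2 : (t / D) ^ (s - 1) ≤ E ^ (1 - s) := by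
          have : t / D ≤ E⁻¹ := by
            rw [div_le_iff₀ hD0, inv_mul_eq_div, le_div_iff₀ hE0]
            nlinarith
          refine (Real.rpow_le_rpow (by positivity) this (by linarith)).trans_eq ?_
          rw [Real.inv_rpow hE0.le, ← Real.rpow_neg hE0.le]
          congr 1
          ring
        have h3 : D⁻¹ ≤ 5 / 4 * ((t + E⁻¹) * (t + E))⁻¹ := by
          rw [← div_eq_mul_inv, le_div_iff₀ (by positivity), inv_mul_le_iff₀ hD0]
          have : (t + E⁻¹) * (t + E) = 1 + t * E + t ^ 2 + t * E⁻¹ := by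
            field_simp; ring
          rw [this, hD]
          nlinarith [mul_le_mul_of_nonneg_left hi ht.le, mul_le_mul_of_nonneg_left hE ht.le]
        rw [h1]
        calc _ ≤ E ^ (1 - s) * (5 / 4 * ((t + E⁻¹) * (t + E))⁻¹) :=
              mul_le_mul h2 h3 (by positivity) (by positivity)
          _ = _ := by ring
    _ = ENNReal.ofReal (5 / 4 * E ^ (1 - s) * (2 * Real.log E / (E - E⁻¹))) := by
        rw [lintegral_const_mul' _ _ ENNReal.ofReal_ne_top, lintegral_inv_add_mul_add_Ioi hE,
          ← ENNReal.ofReal_mul (by positivity)]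
    _ ≤ _ := by
        refine ENNReal.ofReal_le_ofReal ?_
        have h1 : E ^ (1 - s) = E ^ (-s) * E := by
          rw [← Real.rpow_add_one hE0.ne']; congr 1; ring
        have h2 : 2 * Real.log E / (E - E⁻¹) ≤ 2 * Real.log E / (3 / 4 * E) :=
          div_le_div_of_nonneg_left (by positivity) (by positivity) (by linarith)
        calc _ ≤ 5 / 4 * E ^ (1 - s) * (2 * Real.log E / (3 / 4 * E)) :=
              mul_le_mul_of_nonneg_left h2 (by positivity)
          _ = _ := by rw [h1]; field_simp; ring

lemma bubble_rpow {n : ℕ} (hn : 3 ≤ n) (a x : EuclideanSpace ℝ (Fin n)) {lam : ℝ}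
    (hl : 0 < lam) :
    bubble n a lam x ^ ((n : ℝ) / ((n : ℝ) - 2)) =
      (lam⁻¹ + lam * ‖x - a‖ ^ 2) ^ (-((n : ℝ) / 2)) := by
  have hn' : (3 : ℝ) ≤ n := by exact_mod_cast hn
  have h2 : (n : ℝ) - 2 ≠ 0 := by linarith
  have h : lam / (1 + lam ^ 2 * ‖x - a‖ ^ 2) = (lam⁻¹ + lam * ‖x - a‖ ^ 2)⁻¹ := by
    field_simp
  rw [bubble, ← Real.rpow_mul (by positivity), h, Real.inv_rpow (by positivity),
    ← Real.rpow_neg (by positivity)]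
  congr 1
  field_simp

lemma lintegral_bubble_le {n : ℕ} (hn : 3 ≤ n) (a b : EuclideanSpace ℝ (Fin n)) {lam mu : ℝ}
    (hl : 0 < lam) (hm : 0 < mu) {E : ℝ} (hE2 : 2 ≤ E)
    (hE : E = mu / lam + lam / mu + lam * mu * ‖a - b‖ ^ 2) :
    ∫⁻ x, ENNReal.ofReal (bubble n a lam x ^ ((n : ℝ) / ((n : ℝ) - 2)) *
            bubble n b mu x ^ ((n : ℝ) / ((n : ℝ) - 2))) ≤
      ENNReal.ofReal (3 ^ (n : ℝ) *
        ((∫ x : EuclideanSpace ℝ (Fin n), (1 + ‖x‖ ^ 2) ^ (-(n : ℝ))) *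
          (10 / 3 * (E ^ (-((n : ℝ) / 2)) * Real.log E)))) := by
  have hn' : (3 : ℝ) ≤ n := by exact_mod_cast hn
  set K := ∫ x : EuclideanSpace ℝ (Fin n), (1 + ‖x‖ ^ 2) ^ (-(n : ℝ))
  have hK : 0 ≤ K := integral_nonneg fun x => by positivity
  have h2n : 2 * ((n : ℝ) / 2) = n := by ring
  set P := fun x : EuclideanSpace ℝ (Fin n) => lam⁻¹ + lam * ‖x - a‖ ^ 2 with hP
  set Q := fun x : EuclideanSpace ℝ (Fin n) => mu⁻¹ + mu * ‖x - b‖ ^ 2 with hQ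
  have hinner : ∀ t ∈ Ioi (0 : ℝ),
      ∫⁻ x, ENNReal.ofReal (t ^ ((n : ℝ) / 2 - 1) * (P x + t * Q x) ^ (-(n : ℝ))) =
        ENNReal.ofReal K *
          ENNReal.ofReal (t ^ ((n : ℝ) / 2 - 1) * (1 + t * E + t ^ 2) ^ (-((n : ℝ) / 2))) := by
    intro t ht
    have ht : 0 < t := ht
    have hlm : lam + t * mu ≠ 0 := by positivity
    have hPQ : ∀ x, P x + t * Q x =
        (lam⁻¹ + t * mu⁻¹ + lam * (t * mu) / (lam + t * mu) * ‖a - b‖ ^ 2) +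
          (lam + t * mu) * ‖x - (lam + t * mu)⁻¹ • (lam • a + (t * mu) • b)‖ ^ 2 := by
      intro x
      rw [add_assoc (lam⁻¹ + t * mu⁻¹), ← add_mul_add_eq_norm_sq a b x hlm]
      simp only [hP, hQ]
      ring
    simp_rw [hPQ]
    simp_rw [ENNReal.ofReal_mul (Real.rpow_nonneg ht.le _)]
    rw [lintegral_const_mul' _ _ ENNReal.ofReal_ne_top,
      lintegral_rpow_neg_add_mul_norm_sub_sq (by omega) (by positivity) (by positivity),
      ENNReal.ofReal_mul (by positivity)]
    have : (lam + t * mu) *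
        (lam⁻¹ + t * mu⁻¹ + lam * (t * mu) / (lam + t * mu) * ‖a - b‖ ^ 2) =
        1 + t * E + t ^ 2 := by
      rw [hE]
      field_simp
      ring
    rw [this]
    ring
  calc _ ≤ ∫⁻ x, ENNReal.ofReal (3 ^ (n : ℝ)) * ∫⁻ t in Ioi (0 : ℝ),
        ENNReal.ofReal (t ^ ((n : ℝ) / 2 - 1) * (P x + t * Q x) ^ (-(n : ℝ))) := by
        refine lintegral_mono fun x => ?_
        have := ofReal_rpow_neg_mul_rpow_neg_le (p := P x) (q := Q x) (s := (n : ℝ) / 2)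
          (by simp only [hP]; positivity) (by simp only [hQ]; positivity) (by linarith)
        rw [h2n] at this
        rwa [bubble_rpow hn a x hl, bubble_rpow hn b x hm]
    _ = ENNReal.ofReal (3 ^ (n : ℝ)) * ∫⁻ t in Ioi (0 : ℝ), ∫⁻ x,
        ENNReal.ofReal (t ^ ((n : ℝ) / 2 - 1) * (P x + t * Q x) ^ (-(n : ℝ))) := by
        rw [lintegral_const_mul' _ _ ENNReal.ofReal_ne_top, lintegral_lintegral_swap]
        refine Measurable.aemeasurable ?_
        simp only [hP, hQ, Function.uncurry_def]
        fun_prop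
    _ = ENNReal.ofReal (3 ^ (n : ℝ)) * (ENNReal.ofReal K * ∫⁻ t in Ioi (0 : ℝ),
          ENNReal.ofReal (t ^ ((n : ℝ) / 2 - 1) * (1 + t * E + t ^ 2) ^ (-((n : ℝ) / 2)))) := by
        rw [setLIntegral_congr_fun measurableSet_Ioi hinner,
          lintegral_const_mul' _ _ ENNReal.ofReal_ne_top]
    _ ≤ _ := by
        rw [ENNReal.ofReal_mul (by positivity), ENNReal.ofReal_mul hK]
        gcongr
        exact lintegral_rpow_mul_rpow_neg_le (by linarith) hE2

/-- There is a constant `C = C(n) > 0` with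
`∫ U_{a,λ}^{n/(n−2)}·U_{b,μ}^{n/(n−2)} ≤ C·ε^{n/(n−2)}·(1 + |log ε|)`, where
`ε = (μ/λ + λ/μ + λμ|a−b|²)^{−(n−2)/2}` is the bubble interaction. -/
theorem stmt_19 (n : ℕ) (hn : 3 ≤ n) :
    ∃ C : ℝ, 0 < C ∧
      ∀ (a b : EuclideanSpace ℝ (Fin n)) (lam mu : ℝ), 0 < lam → 0 < mu →
        (∫ x, bubble n a lam x ^ ((n : ℝ) / ((n : ℝ) - 2)) *
            bubble n b mu x ^ ((n : ℝ) / ((n : ℝ) - 2)))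
          ≤ C * ((mu / lam + lam / mu + lam * mu * ‖a - b‖ ^ 2) ^
                (-(((n : ℝ) - 2) / 2))) ^ ((n : ℝ) / ((n : ℝ) - 2)) *
              (1 + |Real.log ((mu / lam + lam / mu + lam * mu * ‖a - b‖ ^ 2) ^
                (-(((n : ℝ) - 2) / 2)))|) := by
  have hn' : (3 : ℝ) ≤ n := by exact_mod_cast hn
  set K := ∫ x : EuclideanSpace ℝ (Fin n), (1 + ‖x‖ ^ 2) ^ (-(n : ℝ))
  have hK : 0 ≤ K := integral_nonneg fun x => by positivity
  refine ⟨3 ^ (n : ℝ) * K * (20 / 3) + 1, by positivity, fun a b lam mu hl hm => ?_⟩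
  set E := mu / lam + lam / mu + lam * mu * ‖a - b‖ ^ 2 with hE
  have hE2 : 2 ≤ E := by
    have h1 : 2 ≤ mu / lam + lam / mu := by
      rw [div_add_div _ _ hl.ne' hm.ne', le_div_iff₀ (by positivity)]
      nlinarith [sq_nonneg (mu - lam)]
    have h2 : 0 ≤ lam * mu * ‖a - b‖ ^ 2 := by positivity
    linarith
  have hE0 : 0 < E := by linarith
  have hlog : 0 ≤ Real.log E := Real.log_nonneg (by linarith)
  have heps : (E ^ (-(((n : ℝ) - 2) / 2))) ^ ((n : ℝ) / ((n : ℝ) - 2)) =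
      E ^ (-((n : ℝ) / 2)) := by
    have h2 : (n : ℝ) - 2 ≠ 0 := by linarith
    rw [← Real.rpow_mul hE0.le]
    congr 1
    field_simp
  have habs : |Real.log (E ^ (-(((n : ℝ) - 2) / 2)))| = ((n : ℝ) - 2) / 2 * Real.log E := by
    rw [Real.log_rpow hE0, neg_mul, abs_neg, abs_of_nonneg]
    exact mul_nonneg (by linarith) hlog
  rw [heps, habs]
  have hnonneg : ∀ x, 0 ≤ bubble n a lam x ^ ((n : ℝ) / ((n : ℝ) - 2)) *
      bubble n b mu x ^ ((n : ℝ) / ((n : ℝ) - 2)) := by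
    intro x
    rw [bubble_rpow hn a x hl, bubble_rpow hn b x hm]
    positivity
  have hmeas : AEStronglyMeasurable (fun x => bubble n a lam x ^ ((n : ℝ) / ((n : ℝ) - 2)) *
      bubble n b mu x ^ ((n : ℝ) / ((n : ℝ) - 2))) volume := by
    refine Measurable.aestronglyMeasurable ?_
    unfold bubble
    fun_prop
  rw [integral_eq_lintegral_of_nonneg_ae (Eventually.of_forall hnonneg) hmeas]
  refine (ENNReal.toReal_le_of_le_ofReal (by positivity)
    (lintegral_bubble_le hn a b hl hm hE2 hE)).trans ?_
  have hEs : 0 ≤ E ^ (-((n : ℝ) / 2)) := by positivity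
  have hlog2 : Real.log E ≤ 2 * (1 + ((n : ℝ) - 2) / 2 * Real.log E) := by nlinarith
  have hfac : 0 ≤ 1 + ((n : ℝ) - 2) / 2 * Real.log E := by linarith
  calc 3 ^ (n : ℝ) * (K * (10 / 3 * (E ^ (-((n : ℝ) / 2)) * Real.log E)))
      = 3 ^ (n : ℝ) * K * (10 / 3) * E ^ (-((n : ℝ) / 2)) * Real.log E := by ring
    _ ≤ 3 ^ (n : ℝ) * K * (10 / 3) * E ^ (-((n : ℝ) / 2)) *
          (2 * (1 + ((n : ℝ) - 2) / 2 * Real.log E)) :=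
        mul_le_mul_of_nonneg_left hlog2 (by positivity)
    _ = 3 ^ (n : ℝ) * K * (20 / 3) * E ^ (-((n : ℝ) / 2)) *
          (1 + ((n : ℝ) - 2) / 2 * Real.log E) := by ring
    _ ≤ _ := by
        refine mul_le_mul_of_nonneg_right (mul_le_mul_of_nonneg_right ?_ hEs) hfac
        linarith
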